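/- Let (α_t)_{t≥0} be a nonincreasing sequence of positive reals with ∑_{t=0}^∞ α_t² < ∞, let σ ∈ (0,1) and L > 0, and for each t ≥ 0 let p_{1,t}, …, p_{n,t}, v_{1,t}, …, v_{n,t} and p̄_t be probability density functions on ℝ^d satisfying: (i) ‖v_{i,t} − p̄_t‖_TV ≤ σ ‖p_{i,t} − p̄_t‖_TV for every i; (ii) ‖v_{i,t} − p_{i,t+1}‖_TV ≤ α_t L/2 for every i; and (iii) ‖p̄_t − p̄_{t+1}‖_TV ≤ α_t L/2. Then the series ∑_{t=0}^∞ α_t L ∑_{i=1}^n ‖p̄_t − p_{i,t}‖_TV converges. -/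

import Mathlib

open MeasureTheory

noncomputable section

/-- A probability density function on a measure space: nonnegative, integrable,
integrating to one. -/
def IsPdf {X : Type*} [MeasureSpace X] (p : X → ℝ) : Prop :=
  Integrable p ∧ (∀ x, 0 ≤ p x) ∧ ∫ x, p x = 1

/-- Total variation distance between two densities: `(1/2) ∫ |p - g|`. -/
def TV {X : Type*} [MeasureSpace X] (p g : X → ℝ) : ℝ :=
  (1 / 2) * ∫ x, |p x - g x|

theorem aux_tv_comm {X : Type*} [MeasureSpace X] (p g : X → ℝ) : TV p g = TV g p := by
  simp only [TV, abs_sub_comm]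

theorem aux_tv_nonneg {X : Type*} [MeasureSpace X] (p g : X → ℝ) : 0 ≤ TV p g := by
  unfold TV
  have : 0 ≤ ∫ x, |p x - g x| := integral_nonneg fun x => abs_nonneg _
  linarith

theorem aux_tv_triangle {X : Type*} [MeasureSpace X] (p q g : X → ℝ)
    (hp : IsPdf p) (hq : IsPdf q) (hg : IsPdf g) : TV p g ≤ TV p q + TV q g := by
  have h1 : Integrable fun x => |p x - q x| := (hp.1.sub hq.1).abs
  have h2 : Integrable fun x => |q x - g x| := (hq.1.sub hg.1).abs
  have h3 : Integrable fun x => |p x - g x| := (hp.1.sub hg.1).abs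
  have h : ∫ x, |p x - g x| ≤ ∫ x, (|p x - q x| + |q x - g x|) :=
    integral_mono h3 (h1.add h2) fun x => abs_sub_le _ _ _
  rw [integral_add h1 h2] at h
  unfold TV
  linarith

theorem aux_summable (a b : ℕ → ℝ) (σ : ℝ) (hσ1 : σ < 1) (ha : ∀ t, 0 ≤ a t)
    (hb0 : ∀ t, 0 ≤ b t) (hb : Summable b) (hab : ∀ t, a (t + 1) ≤ σ * a t + b t) :
    Summable a := by
  have key : ∀ N, (1 - σ) * ∑ t ∈ Finset.range N, a t + a N
      ≤ a 0 + ∑ t ∈ Finset.range N, b t := by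
    intro N
    induction N with
    | zero => simp
    | succ N ih =>
      rw [Finset.sum_range_succ, Finset.sum_range_succ]
      linarith [hab N]
  refine summable_of_sum_range_le (c := (a 0 + ∑' t, b t) / (1 - σ)) ha fun N => ?_
  rw [le_div_iff₀ (by linarith)]
  have := hb.sum_le_tsum (Finset.range N) (fun t _ => hb0 t)
  linarith [key N, ha N]

/-- Summability of the weighted consensus errors: under the mixing contraction
and the bounded-displacement estimates, the series
`∑_t α_t L ∑_i ‖p̄_t − p_{i,t}‖_TV` converges. -/
theorem consensus_error_summable {d n : ℕ}
    (α : ℕ → ℝ) (hα_pos : ∀ t, 0 < α t) (hα_mono : Antitone α)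
    (hα_sq : Summable fun t => (α t) ^ 2)
    (σ L : ℝ) (hσ0 : 0 < σ) (hσ1 : σ < 1) (hL : 0 < L)
    (p v : Fin n → ℕ → (Fin d → ℝ) → ℝ) (pbar : ℕ → (Fin d → ℝ) → ℝ)
    (hp : ∀ i t, IsPdf (p i t)) (hv : ∀ i t, IsPdf (v i t))
    (hpbar : ∀ t, IsPdf (pbar t))
    (hcontract : ∀ i t, TV (v i t) (pbar t) ≤ σ * TV (p i t) (pbar t))
    (hupdate : ∀ i t, TV (v i t) (p i (t + 1)) ≤ α t * L / 2)
    (hbar : ∀ t, TV (pbar t) (pbar (t + 1)) ≤ α t * L / 2) :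
    Summable fun t => α t * L * ∑ i, TV (pbar t) (p i t) := by
  have hi : ∀ i, Summable fun t => α t * TV (pbar t) (p i t) := by
    intro i
    refine aux_summable _ (fun t => L * α t ^ 2) σ hσ1
      (fun t => mul_nonneg (hα_pos t).le (aux_tv_nonneg _ _))
      (fun t => by positivity) (hα_sq.mul_left L) fun t => ?_
    have e : TV (pbar (t + 1)) (p i (t + 1)) ≤ σ * TV (pbar t) (p i t) + α t * L := by
      have h1 := aux_tv_triangle _ _ _ (hpbar (t + 1)) (hpbar t) (hp i (t + 1))
      have h2 := aux_tv_triangle _ _ _ (hpbar t) (hv i t) (hp i (t + 1))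
      have h3 := hcontract i t
      rw [aux_tv_comm (v i t), aux_tv_comm (p i t)] at h3
      rw [aux_tv_comm (pbar (t + 1)) (pbar t)] at h1
      linarith [hupdate i t, hbar t]
    calc α (t + 1) * TV (pbar (t + 1)) (p i (t + 1))
        ≤ α t * TV (pbar (t + 1)) (p i (t + 1)) :=
          mul_le_mul_of_nonneg_right (hα_mono (Nat.le_succ t)) (aux_tv_nonneg _ _)
      _ ≤ α t * (σ * TV (pbar t) (p i t) + α t * L) :=
          mul_le_mul_of_nonneg_left e (hα_pos t).le
      _ = _ := by ring
  have hs : Summable fun t => L * ∑ i, α t * TV (pbar t) (p i t) :=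
    (summable_sum fun i _ => hi i).mul_left L
  refine hs.congr fun t => ?_
  rw [← Finset.mul_sum]
  ring
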